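/- Let G be a Θ3-graph of order n ≥ 12 that is not isomorphic to F_n. Then Sz*(G) < B(n), where B(n) = (n³ + 2n² − 16)/4 if n is even and B(n) = (n³ + 2n² − 18)/4 if n is odd. -/

import Mathlib

attribute [local instance] Classical.propDecidable

noncomputable def nC {V : Type*} [Fintype V] (G : SimpleGraph V) (u v : V) : ℕ :=
  (Finset.univ.filter fun w => G.dist u w < G.dist v w).card

noncomputable def nE {V : Type*} [Fintype V] (G : SimpleGraph V) (u v : V) : ℕ :=
  (Finset.univ.filter fun w => G.dist u w = G.dist v w).card

lemma nE_comm {V : Type*} [Fintype V] (G : SimpleGraph V) (u v : V) :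
    nE G u v = nE G v u := by
  unfold nE; congr 1; ext w; simp [eq_comm]

noncomputable def szContrib {V : Type*} [Fintype V] (G : SimpleGraph V) : Sym2 V → ℚ :=
  Sym2.lift ⟨fun u v =>
    ((nC G u v : ℚ) + (nE G u v : ℚ) / 2) * ((nC G v u : ℚ) + (nE G u v : ℚ) / 2),
    fun u v => by dsimp only; rw [nE_comm]; ring⟩

noncomputable def revSz {V : Type*} [Fintype V] (G : SimpleGraph V) : ℚ :=
  ∑ e ∈ G.edgeFinset, szContrib G e
/-- Two paths are internally disjoint if every common vertex is an endpoint of both. -/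
def IntDisj {V : Type*} {G : SimpleGraph V} {x y x' y' : V}
    (P : G.Walk x y) (Q : G.Walk x' y') : Prop :=
  ∀ v : V, v ∈ P.support → v ∈ Q.support → (v = x ∨ v = y) ∧ (v = x' ∨ v = y')
/-- `G` consists of the four distinct vertices `w, y, x, z`, two internally disjoint
paths `Q₁, Q₂` joining `w` and `y`, two internally disjoint paths `R₁, R₂` joining
`x` and `z`, a path `S` joining `w` and `x`, and a path `T` joining `y` and `z`,
all pairwise internally disjoint, every vertex and every edge of `G` lying on one of
these paths. -/
def Theta3Cond {V : Type*} (G : SimpleGraph V) (w y x z : V)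
    (Q₁ Q₂ : G.Walk w y) (R₁ R₂ : G.Walk x z) (S : G.Walk w x) (T : G.Walk y z) : Prop :=
  w ≠ y ∧ w ≠ x ∧ w ≠ z ∧ y ≠ x ∧ y ≠ z ∧ x ≠ z ∧
  Q₁.IsPath ∧ Q₂.IsPath ∧ R₁.IsPath ∧ R₂.IsPath ∧ S.IsPath ∧ T.IsPath ∧
  Q₁ ≠ Q₂ ∧ R₁ ≠ R₂ ∧
  IntDisj Q₁ Q₂ ∧ IntDisj Q₁ R₁ ∧ IntDisj Q₁ R₂ ∧ IntDisj Q₁ S ∧ IntDisj Q₁ T ∧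
  IntDisj Q₂ R₁ ∧ IntDisj Q₂ R₂ ∧ IntDisj Q₂ S ∧ IntDisj Q₂ T ∧
  IntDisj R₁ R₂ ∧ IntDisj R₁ S ∧ IntDisj R₁ T ∧
  IntDisj S T ∧ IntDisj R₂ S ∧ IntDisj R₂ T ∧
  (∀ v : V, v ∈ Q₁.support ∨ v ∈ Q₂.support ∨ v ∈ R₁.support ∨ v ∈ R₂.support ∨
    v ∈ S.support ∨ v ∈ T.support) ∧
  (∀ e ∈ G.edgeSet, e ∈ Q₁.edges ∨ e ∈ Q₂.edges ∨ e ∈ R₁.edges ∨ e ∈ R₂.edges ∨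
    e ∈ S.edges ∨ e ∈ T.edges)

/-- `G` is a Θ₃-graph. -/
def IsTheta3 {V : Type*} (G : SimpleGraph V) : Prop :=
  ∃ (w y x z : V) (Q₁ Q₂ : G.Walk w y) (R₁ R₂ : G.Walk x z) (S : G.Walk w x)
    (T : G.Walk y z), Theta3Cond G w y x z Q₁ Q₂ R₁ R₂ S T

/-- `G` is the Θ₃-graph in which the two paths joining `w` and `y` have length 2,
the two paths joining `x` and `z` have length 2, the path joining `w` and `x` has
length `a` and the path joining `y` and `z` has length `b`, where `a + b + 6 = n`,
`0 < a`, and `b = a + 2` if `n` is even, `b = a + 3` if `n` is odd; i.e. `G ≅ Fₙ`. -/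
def IsFGraph {V : Type*} (n : ℕ) (G : SimpleGraph V) : Prop :=
  ∃ (a b : ℕ), 0 < a ∧ 0 < b ∧ a + b + 6 = n ∧
    (if Even n then b = a + 2 else b = a + 3) ∧
    ∃ (w y x z : V) (Q₁ Q₂ : G.Walk w y) (R₁ R₂ : G.Walk x z) (S : G.Walk w x)
      (T : G.Walk y z), Theta3Cond G w y x z Q₁ Q₂ R₁ R₂ S T ∧
      Q₁.length = 2 ∧ Q₂.length = 2 ∧ R₁.length = 2 ∧ R₂.length = 2 ∧
      S.length = a ∧ T.length = b

open Finset

section Transmission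

variable {V : Type*} {G : SimpleGraph V}

lemma dist_le_dist_add_one (hG : G.Connected) {u v : V} (h : G.Adj u v) (x : V) :
    G.dist u x ≤ G.dist v x + 1 := by
  have := hG.dist_triangle (u := u) (v := v) (w := x)
  rw [SimpleGraph.dist_eq_one_iff_adj.mpr h] at this
  omega

lemma exists_adj_dist_add_one_eq (hG : G.Connected) {u x : V} (h : u ≠ x) :
    ∃ v, G.Adj u v ∧ G.dist v x + 1 = G.dist u x := by
  obtain ⟨p, hp⟩ := hG.exists_walk_length_eq_dist u x
  cases p with
  | nil => exact absurd rfl h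
  | cons ha q =>
    refine ⟨_, ha, le_antisymm ?_ (dist_le_dist_add_one hG ha x)⟩
    rw [← hp, SimpleGraph.Walk.length_cons]
    exact Nat.add_le_add_right (SimpleGraph.dist_le q) 1

/-- The sum of the distances from `v` to all vertices. -/
noncomputable def transmission [Fintype V] (G : SimpleGraph V) (v : V) : ℤ :=
  ∑ x, (G.dist v x : ℤ)

/-- The squared transmission difference of the two ends of an edge. -/
noncomputable def transGap [Fintype V] (G : SimpleGraph V) : Sym2 V → ℤ :=
  Sym2.lift ⟨fun u v => (transmission G u - transmission G v) ^ 2, fun u v => by ring⟩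

lemma transGap_nonneg [Fintype V] (e : Sym2 V) : 0 ≤ transGap G e := by
  induction e with | _ u v => exact sq_nonneg _

lemma szContrib_eq [Fintype V] (hG : G.Connected) {e : Sym2 V} (he : e ∈ G.edgeSet) :
    szContrib G e = ((Fintype.card V : ℚ) ^ 2 - (transGap G e : ℤ)) / 4 := by
  induction e with | _ u v =>
  have hadj : G.Adj u v := he
  have h1 : nC G u v + nC G v u + nE G u v = Fintype.card V := by
    have : ∀ x : V, 1 = (if G.dist u x < G.dist v x then 1 else 0)
        + (if G.dist v x < G.dist u x then 1 else 0)
        + (if G.dist u x = G.dist v x then 1 else 0) := by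
      intro x; split_ifs <;> omega
    rw [nC, nC, nE, card_filter, card_filter, card_filter, ← sum_add_distrib,
      ← sum_add_distrib, ← Finset.card_univ, card_eq_sum_ones]
    exact (sum_congr rfl fun x _ => this x).symm
  have h2 : (nC G v u : ℤ) - nC G u v = transmission G u - transmission G v := by
    rw [nC, nC, card_filter, card_filter, transmission, transmission]
    push_cast
    rw [← sum_sub_distrib, ← sum_sub_distrib]
    refine sum_congr rfl fun x _ => ?_
    have h3 := dist_le_dist_add_one hG hadj x
    have h4 := dist_le_dist_add_one hG hadj.symm x
    split_ifs <;> omega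
  have h1' : (nC G u v : ℚ) + nC G v u + nE G u v = Fintype.card V := by exact_mod_cast h1
  have h2' : (nC G v u : ℚ) - nC G u v = (transmission G u : ℚ) - transmission G v := by
    exact_mod_cast h2
  simp only [szContrib, transGap, Sym2.lift_mk]
  push_cast
  rw [← h1', ← h2']
  ring

lemma revSz_eq [Fintype V] (hG : G.Connected) :
    revSz G = ((#G.edgeFinset : ℚ) * (Fintype.card V : ℚ) ^ 2
      - (∑ e ∈ G.edgeFinset, transGap G e : ℤ)) / 4 := by
  rw [revSz, sum_congr rfl fun e he => szContrib_eq hG (SimpleGraph.mem_edgeFinset.mp he),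
    ← sum_div, sum_sub_distrib, sum_const, nsmul_eq_mul]
  push_cast
  rfl

end Transmission

section Ear

variable {V : Type*} {G : SimpleGraph V}

/-- `p 0, …, p L` is a path of `G` all of whose inner vertices have degree two. -/
structure IsEar (G : SimpleGraph V) (p : ℕ → V) (L : ℕ) : Prop where
  pos : 0 < L
  adj : ∀ i < L, G.Adj (p i) (p (i + 1))
  inj : Set.InjOn p {i | i ≤ L}
  nbr : ∀ i x, 0 < i → i < L → G.Adj (p i) x → x = p (i - 1) ∨ x = p (i + 1)

namespace IsEar

variable {p : ℕ → V} {L : ℕ}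

lemma reverse (h : IsEar G p L) : IsEar G (fun i => p (L - i)) L where
  pos := h.pos
  adj i hi := by
    have := h.adj (L - (i + 1)) (by omega)
    rw [show L - (i + 1) + 1 = L - i by omega] at this
    exact this.symm
  inj i hi j hj hij := by
    have hi' : i ≤ L := hi
    have hj' : j ≤ L := hj
    have : L - i = L - j := h.inj (Nat.sub_le L i) (Nat.sub_le L j) hij
    omega
  nbr i x h0 hL hx := by
    have := h.nbr (L - i) x (by omega) (by omega) hx
    rwa [show L - i - 1 = L - (i + 1) by omega, show L - i + 1 = L - (i - 1) by omega,
      or_comm] at this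

lemma initial (h : IsEar G p L) {k : ℕ} (h0 : 0 < k) (hk : k ≤ L) : IsEar G p k where
  pos := h0
  adj i hi := h.adj i (by omega)
  inj := h.inj.mono fun _ hi => le_trans hi hk
  nbr i x hi hik := h.nbr i x hi (by omega)

lemma apply_ne (h : IsEar G p L) {i j : ℕ} (hi : i ≤ L) (hj : j ≤ L) (hij : i ≠ j) :
    p i ≠ p j := fun e => hij (h.inj hi hj e)

lemma dist_le_add (h : IsEar G p L) (hG : G.Connected) (x : V) {i : ℕ} (hi : i ≤ L) :
    G.dist (p i) x ≤ i + G.dist (p 0) x := by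
  induction i with
  | zero => omega
  | succ i ih =>
    have := dist_le_dist_add_one hG (h.adj i (by omega)).symm x
    have := ih (by omega)
    omega

theorem dist_eq (h : IsEar G p L) (hG : G.Connected) {x : V}
    (hx : ∀ i, 0 < i → i < L → p i ≠ x) {i : ℕ} (hi : i ≤ L) :
    G.dist (p i) x = min (i + G.dist (p 0) x) (L - i + G.dist (p L) x) := by
  have hle₁ := h.dist_le_add hG x hi
  have hle₂ := h.reverse.dist_le_add hG x (Nat.sub_le L i)
  simp only [Nat.sub_zero, Nat.sub_sub_self hi] at hle₂
  have key : ∀ k i, i ≤ L → G.dist (p i) x = k →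
      min (i + G.dist (p 0) x) (L - i + G.dist (p L) x) ≤ k := by
    intro k
    induction k with
    | zero =>
      intro i hi h0
      have : p i = x := hG.dist_eq_zero_iff.mp h0
      rcases Nat.eq_zero_or_pos i with rfl | hi0
      · omega
      · rcases hi.eq_or_lt with rfl | hiL
        · omega
        · exact absurd this (hx i hi0 hiL)
    | succ k ih =>
      intro i hi hk
      rcases Nat.eq_zero_or_pos i with rfl | hi0
      · omega
      rcases hi.eq_or_lt with rfl | hiL
      · omega
      obtain ⟨v, hv, hvx⟩ := exists_adj_dist_add_one_eq hG (hx i hi0 hiL)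
      rcases h.nbr i v hi0 hiL hv with rfl | rfl
      · have := ih (i - 1) (by omega) (by omega)
        omega
      · have := ih (i + 1) (by omega) (by omega)
        omega
  have := key _ i hi rfl
  omega

lemma dist_ends_le (h : IsEar G p L) (hG : G.Connected) : G.dist (p 0) (p L) ≤ L := by
  have := h.dist_le_add hG (p 0) le_rfl
  rwa [SimpleGraph.dist_self, SimpleGraph.dist_comm] at this

/-- A shortest path that starts along an ear runs through the whole ear. -/
lemma dist_zero_eq_of_dist_one (h : IsEar G p L) (hG : G.Connected) {x : V}
    (hx : ∀ i, 0 < i → i < L → p i ≠ x) (h1 : G.dist (p 1) x + 1 = G.dist (p 0) x) :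
    G.dist (p 0) x = L + G.dist (p L) x := by
  have := h.dist_eq hG hx (i := 1) h.pos
  have := h.pos
  omega

/-- The vertices that are not inner vertices of the ear. -/
noncomputable def outer [Fintype V] (p : ℕ → V) (L : ℕ) : Finset V :=
  univ \ (Ioo 0 L).image p

lemma mem_outer [Fintype V] {x : V} : x ∈ outer p L ↔ ∀ i, 0 < i → i < L → p i ≠ x := by
  simp [outer]

lemma start_mem_outer [Fintype V] (h : IsEar G p L) : p 0 ∈ outer p L :=
  mem_outer.mpr fun _ h0 hi => h.apply_ne hi.le (Nat.zero_le L) h0.ne'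

lemma end_mem_outer [Fintype V] (h : IsEar G p L) : p L ∈ outer p L :=
  mem_outer.mpr fun _ _ hi => h.apply_ne hi.le le_rfl hi.ne

lemma injOn_Ioo (h : IsEar G p L) : Set.InjOn p (Ioo 0 L : Finset ℕ) :=
  h.inj.mono fun i hi => by simp at hi; exact hi.2.le

lemma sum_eq [Fintype V] (h : IsEar G p L) (f : V → ℤ) :
    ∑ x, f x = ∑ i ∈ Ioo 0 L, f (p i) + ∑ x ∈ outer p L, f x := by
  rw [outer, ← sum_image (f := f) h.injOn_Ioo, add_comm]
  exact (sum_sdiff (subset_univ _)).symm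

lemma card_outer [Fintype V] (h : IsEar G p L) :
    (#(outer p L) : ℤ) = Fintype.card V - (L - 1) := by
  have := h.sum_eq fun _ => 1
  have hL := h.pos
  simp only [sum_const, Nat.card_Ioo, Finset.card_univ] at this
  simp only [nsmul_eq_mul, mul_one] at this
  omega

lemma outer_reverse [Fintype V] :
    outer (fun i => p (L - i)) L = outer p L := by
  ext x
  rw [mem_outer, mem_outer]
  constructor
  · intro hx i h0 hL
    have := hx (L - i) (by omega) (by omega)
    rwa [Nat.sub_sub_self hL.le] at this
  · intro hx i h0 hL
    exact hx (L - i) (by omega) (by omega)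

end IsEar

/-- The weight with which a vertex outside an ear of length `L` contributes to the sum of the
transmission differences along the two end edges of the ear. -/
def weight (L v : ℤ) : ℤ := min 1 (v + L - 1) + min 1 (L - 1 - v)

lemma sum_range_sign (M m : ℕ) (g : ℕ → ℤ) (h₁ : ∀ k ≤ m, 2 * k ≤ M → g k = -1)
    (h₂ : ∀ k ≤ m, 2 * k = M + 1 → g k = 0) (h₃ : ∀ k ≤ m, M + 2 ≤ 2 * k → g k = 1) :
    ∑ k ∈ range (m + 1), g k = max (-((m : ℤ) + 1)) ((m : ℤ) - M - 1) := by
  induction m with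
  | zero =>
    have := h₁ 0 le_rfl (by omega)
    simp [this]
  | succ m ih =>
    rw [sum_range_succ, ih (fun k hk => h₁ k (by omega)) (fun k hk => h₂ k (by omega))
      (fun k hk => h₃ k (by omega))]
    rcases lt_trichotomy (2 * (m + 1)) (M + 1) with h | h | h
    · rw [h₁ _ le_rfl (by omega)]; push_cast; omega
    · rw [h₂ _ le_rfl h]; push_cast; omega
    · rw [h₃ _ le_rfl (by omega)]; push_cast; omega

namespace IsEar

variable {p : ℕ → V} {L : ℕ}

lemma sum_inner (h : IsEar G p L) (hG : G.Connected) :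
    ∑ k ∈ Ioo 0 L, ((G.dist (p 1) (p k) : ℤ) - G.dist (p 0) (p k))
      = -min ((L : ℤ) - 1) (G.dist (p 0) (p L) + 1) := by
  have hL := h.pos
  have h0 : ∀ k, 0 < k → k < L →
      G.dist (p 0) (p k) = min k (L - k + G.dist (p 0) (p L)) := by
    intro k hk0 hkL
    have := h.dist_eq hG (x := p 0) (fun i hi hiL => h.apply_ne hiL.le (by omega) (by omega)) hkL.le
    rw [SimpleGraph.dist_self] at this
    rw [SimpleGraph.dist_comm, this, SimpleGraph.dist_comm (u := p L)]
    rfl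
  have h1 : ∀ k, 0 < k → k < L →
      G.dist (p 1) (p k) = min (1 + G.dist (p 0) (p k)) (k - 1) := by
    intro k hk0 hkL
    have := (h.initial hk0 hkL.le).dist_eq hG (x := p k)
      (fun i hi hiL => h.apply_ne (by omega) (by omega) (by omega)) (i := 1) hk0
    rwa [SimpleGraph.dist_self] at this
  have h2 : ∀ k, 0 < k → k < L → (G.dist (p 1) (p k) : ℤ) - G.dist (p 0) (p k)
      = min (1 : ℤ) (k - 1 - min (k : ℤ) (L - k + G.dist (p 0) (p L))) := by
    intro k hk0 hkL
    have := h0 k hk0 hkL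
    have := h1 k hk0 hkL
    omega
  rcases Nat.exists_eq_succ_of_ne_zero hL.ne' with ⟨l, rfl⟩
  have h3 : Ioo 0 l.succ = (range l).map ⟨Nat.succ, Nat.succ_injective⟩ := by
    ext a
    simp only [mem_Ioo, mem_map, mem_range, Function.Embedding.coeFn_mk]
    constructor
    · rintro ⟨h1, h2⟩
      exact ⟨a - 1, by omega, by omega⟩
    · rintro ⟨b, hb, rfl⟩
      omega
  rw [h3, sum_map]
  simp only [Function.Embedding.coeFn_mk]
  cases l with
  | zero => simp; omega
  | succ l =>
    rw [sum_range_sign (l + G.dist (p 0) (p (l + 1).succ))]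
    · push_cast; omega
    all_goals
      intro k hk hk'
      rw [h2 _ (by omega) (by omega)]
      push_cast
      omega

theorem transmission_sub (h : IsEar G p L) [Fintype V] (hG : G.Connected) :
    transmission G (p 1) - transmission G (p 0)
      = -min ((L : ℤ) - 1) (G.dist (p 0) (p L) + 1)
        + ∑ x ∈ outer p L, min 1 ((G.dist (p L) x : ℤ) - G.dist (p 0) x + L - 1) := by
  rw [transmission, transmission, ← sum_sub_distrib, h.sum_eq, h.sum_inner hG]
  congr 1
  refine sum_congr rfl fun x hx => ?_
  have := h.dist_eq hG (mem_outer.mp hx) (i := 1) h.pos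
  have := h.pos
  omega

theorem transmission_ends (h : IsEar G p L) [Fintype V] (hG : G.Connected) :
    (transmission G (p 1) - transmission G (p 0))
        + (transmission G (p (L - 1)) - transmission G (p L))
      = -2 * min ((L : ℤ) - 1) (G.dist (p 0) (p L) + 1)
        + ∑ x ∈ outer p L, weight L ((G.dist (p L) x : ℤ) - G.dist (p 0) x) := by
  have h1 := h.transmission_sub hG
  have h2 := h.reverse.transmission_sub hG
  rw [outer_reverse] at h2
  simp only [Nat.sub_zero, Nat.sub_self, SimpleGraph.dist_comm (u := p L) (v := p 0)] at h2
  rw [h1, h2]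
  simp only [weight, sum_add_distrib]
  have : ∀ x, (G.dist (p 0) x : ℤ) - G.dist (p L) x + L - 1
    = L - 1 - ((G.dist (p L) x : ℤ) - G.dist (p 0) x) := fun x => by ring
  simp only [this]
  ring

end IsEar

end Ear

section Crossing

variable {V : Type*} {G : SimpleGraph V}

/-- The difference of the distances of `x` from `b` and from `a`. -/
noncomputable def offset (G : SimpleGraph V) (a b x : V) : ℤ := G.dist b x - G.dist a x

lemma abs_offset_le (hG : G.Connected) (a b x : V) : |offset G a b x| ≤ G.dist a b := by
  have h1 := hG.dist_triangle (u := a) (v := b) (w := x)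
  have h2 := hG.dist_triangle (u := b) (v := a) (w := x)
  rw [SimpleGraph.dist_comm (u := b) (v := a)] at h2
  rw [offset, abs_le]
  omega

lemma weight_nonneg {D v : ℤ} (hD : 1 ≤ D) (hv : |v| ≤ D) : 0 ≤ weight D v := by
  rw [abs_le] at hv
  unfold weight
  omega

/-- Twice the total weight along a walk bounds the change of the potential
`max (min (2 * v) (v + D - 2)) (v - (D - 2))` of the offset. -/
lemma potential_le (hG : G.Connected) (a b : V) (hD : 2 ≤ G.dist a b) {x y : V}
    (W : G.Walk x y) :
    let D : ℤ := G.dist a b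
    let H : ℤ → ℤ := fun v => max (min (2 * v) (v + D - 2)) (v - (D - 2))
    H (offset G a b x) - H (offset G a b y) + weight D (offset G a b x)
        + weight D (offset G a b y)
      ≤ 2 * (W.support.map fun v => weight D (offset G a b v)).sum := by
  intro D H
  induction W with
  | nil => simp; omega
  | @cons x m y hadj W ih =>
    simp only [SimpleGraph.Walk.support_cons, List.map_cons, List.sum_cons]
    have hx := abs_le.mp (abs_offset_le hG a b x)
    have hm := abs_le.mp (abs_offset_le hG a b m)
    have h : H (offset G a b x) - H (offset G a b m)
        ≤ weight D (offset G a b x) + weight D (offset G a b m) := by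
      have h1 := dist_le_dist_add_one hG hadj a
      have h2 := dist_le_dist_add_one hG hadj b
      have h3 := dist_le_dist_add_one hG hadj.symm a
      have h4 := dist_le_dist_add_one hG hadj.symm b
      simp only [SimpleGraph.dist_comm (v := a), SimpleGraph.dist_comm (v := b)] at h1 h2 h3 h4
      have : |offset G a b x - offset G a b m| ≤ 2 := by
        simp only [offset, abs_le]; omega
      rw [abs_le] at this
      simp only [H, weight]
      omega
    omega

theorem crossing (hG : G.Connected) {a b : V} (hab : a ≠ b) {W : G.Walk a b} (hW : W.IsPath) :
    2 * ((G.dist a b : ℤ) - 1)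
      ≤ ∑ x ∈ W.support.toFinset, weight (G.dist a b) (offset G a b x) := by
  have hpos : 0 < G.dist a b := hG.pos_dist_of_ne hab
  rcases Nat.lt_or_ge (G.dist a b) 2 with h | h
  · have : (0 : ℤ) ≤ ∑ x ∈ W.support.toFinset, weight (G.dist a b) (offset G a b x) :=
      sum_nonneg fun x _ => weight_nonneg (by omega) (abs_offset_le hG a b x)
    omega
  · have := potential_le hG a b h W
    rw [List.sum_toFinset _ hW.support_nodup]
    simp only [weight, offset, SimpleGraph.dist_self, SimpleGraph.dist_comm (u := b) (v := a)]
      at this ⊢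
    omega

/-- Two paths from `a` to `b` that meet only in their ends. -/
lemma crossing_two (hG : G.Connected) {a b : V} (hab : a ≠ b) {W W' : G.Walk a b}
    (hW : W.IsPath) (hW' : W'.IsPath)
    (hd : ∀ v, v ∈ W.support → v ∈ W'.support → v = a ∨ v = b) {U : Finset V}
    (hU : ∀ v ∈ W.support, v ∈ U) (hU' : ∀ v ∈ W'.support, v ∈ U) :
    4 * ((G.dist a b : ℤ) - 1) ≤ ∑ x ∈ U, weight (G.dist a b) (offset G a b x) := by
  have hpos : 0 < G.dist a b := hG.pos_dist_of_ne hab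
  have h1 := crossing hG hab hW
  have h2 := crossing hG hab hW'
  have h3 := sum_union_inter (s₁ := W.support.toFinset) (s₂ := W'.support.toFinset)
    (f := fun x => weight (G.dist a b) (offset G a b x))
  have h4 : ∑ x ∈ W.support.toFinset ∩ W'.support.toFinset,
      weight (G.dist a b) (offset G a b x) = 0 := by
    refine sum_eq_zero fun x hx => ?_
    simp only [mem_inter, List.mem_toFinset] at hx
    rcases hd x hx.1 hx.2 with rfl | rfl
    · simp only [weight, offset, SimpleGraph.dist_self, SimpleGraph.dist_comm (u := b)]
      omega
    · simp only [weight, offset, SimpleGraph.dist_self]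
      omega
  have h5 : ∑ x ∈ W.support.toFinset ∪ W'.support.toFinset,
      weight (G.dist a b) (offset G a b x)
        ≤ ∑ x ∈ U, weight (G.dist a b) (offset G a b x) := by
    refine sum_le_sum_of_subset_of_nonneg ?_
      fun x _ _ => weight_nonneg (by omega) (abs_offset_le hG a b x)
    intro x hx
    simp only [mem_union, List.mem_toFinset] at hx
    exact hx.elim (hU x) (hU' x)
  omega

end Crossing

section Energy

variable {V : Type*} [Fintype V] {G : SimpleGraph V} {p : ℕ → V} {L : ℕ}

/-- The sum of the squared transmission differences along `p 0, …, p L`. -/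
noncomputable def energy (G : SimpleGraph V) (p : ℕ → V) (L : ℕ) : ℤ :=
  ∑ i ∈ range L, transGap G s(p i, p (i + 1))

lemma energy_nonneg : 0 ≤ energy G p L := sum_nonneg fun _ _ => transGap_nonneg _

/-- The sum of the inward transmission differences along the two end edges. -/
noncomputable def endGap (G : SimpleGraph V) (p : ℕ → V) (L : ℕ) : ℤ :=
  (transmission G (p 1) - transmission G (p 0))
    + (transmission G (p (L - 1)) - transmission G (p L))

lemma sq_add_sq_le_energy (hL : 2 ≤ L) :
    (transmission G (p 1) - transmission G (p 0)) ^ 2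
      + (transmission G (p (L - 1)) - transmission G (p L)) ^ 2 ≤ energy G p L := by
  obtain ⟨l, rfl⟩ := Nat.exists_eq_add_of_le' hL
  rw [energy, sum_range_succ, sum_range_succ']
  have : (0 : ℤ) ≤ ∑ i ∈ range l, transGap G s(p (i + 1), p (i + 1 + 1)) :=
    sum_nonneg fun _ _ => transGap_nonneg _
  have h0 : transGap G s(p 0, p (0 + 1)) = (transmission G (p 1) - transmission G (p 0)) ^ 2 := by
    simp only [transGap, Sym2.lift_mk]; ring
  have h1 : transGap G s(p (l + 1), p (l + 1 + 1))
      = (transmission G (p (l + 2 - 1)) - transmission G (p (l + 2))) ^ 2 := rfl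
  rw [h0, h1]
  linarith

lemma sq_endGap_le (hL : 2 ≤ L) : endGap G p L ^ 2 ≤ 2 * energy G p L := by
  have := sq_add_sq_le_energy (G := G) (p := p) hL
  unfold endGap
  nlinarith [sq_nonneg ((transmission G (p 1) - transmission G (p 0))
    - (transmission G (p (L - 1)) - transmission G (p L)))]

namespace IsEar

lemma endGap_eq (h : IsEar G p L) (hG : G.Connected) :
    endGap G p L = -2 * min ((L : ℤ) - 1) (G.dist (p 0) (p L) + 1)
      + ∑ x ∈ outer p L, weight L (offset G (p 0) (p L) x) :=
  h.transmission_ends hG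

lemma endGap_of_eq_dist (h : IsEar G p L) (hG : G.Connected) (hL : L = G.dist (p 0) (p L))
    (hX : 4 * ((G.dist (p 0) (p L) : ℤ) - 1)
      ≤ ∑ x ∈ outer p L, weight (G.dist (p 0) (p L)) (offset G (p 0) (p L) x)) :
    2 * ((L : ℤ) - 1) ≤ endGap G p L := by
  rw [h.endGap_eq hG]
  rw [← hL] at hX ⊢
  omega

lemma endGap_of_eq_dist_add_one (h : IsEar G p L) (hG : G.Connected)
    (hL : L = G.dist (p 0) (p L) + 1) (h0 : p 0 ≠ p L)
    (hX : 4 * ((G.dist (p 0) (p L) : ℤ) - 1)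
      ≤ ∑ x ∈ outer p L, weight (G.dist (p 0) (p L)) (offset G (p 0) (p L) x)) :
    (Fintype.card V : ℤ) - L - 1 ≤ endGap G p L := by
  have hpos : 0 < G.dist (p 0) (p L) := hG.pos_dist_of_ne h0
  have hU := h.card_outer
  rw [h.endGap_eq hG]
  have : ∑ x ∈ outer p L, (2 + weight (G.dist (p 0) (p L)) (offset G (p 0) (p L) x))
      ≤ ∑ x ∈ outer p L, 2 * weight L (offset G (p 0) (p L) x) := by
    refine sum_le_sum fun x _ => ?_
    have := abs_le.mp (abs_offset_le hG (p 0) (p L) x)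
    unfold weight
    omega
  rw [sum_add_distrib, ← mul_sum, sum_const, nsmul_eq_mul] at this
  omega

lemma endGap_of_dist_add_two_le (h : IsEar G p L) (hG : G.Connected)
    (hL : G.dist (p 0) (p L) + 2 ≤ L) :
    2 * ((Fintype.card V : ℤ) - L - G.dist (p 0) (p L)) ≤ endGap G p L := by
  have hU := h.card_outer
  rw [h.endGap_eq hG]
  have : ∑ x ∈ outer p L, weight L (offset G (p 0) (p L) x) = ∑ x ∈ outer p L, 2 := by
    refine sum_congr rfl fun x _ => ?_
    have := abs_le.mp (abs_offset_le hG (p 0) (p L) x)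
    unfold weight
    omega
  rw [this, sum_const, nsmul_eq_mul]
  omega

end IsEar
end Energy

section EarPair

variable {V : Type*} [Fintype V] {G : SimpleGraph V} {a b : V} {p q : ℕ → V} {L M : ℕ}

/-- Two ears with common ends `a, b`. The second alternative is the 4-cycle. -/
lemma energy_add_energy_aux (hG : G.Connected) (hab : a ≠ b) (hp : IsEar G p L) (hq : IsEar G q M)
    (hp0 : p 0 = a) (hpL : p L = b) (hq0 : q 0 = a) (hqM : q M = b) (hLM : L ≤ M) (hM : 2 ≤ M)
    (hn : L + M + 3 ≤ Fintype.card V) (hn' : 12 ≤ Fintype.card V)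
    (hXp : 4 * ((G.dist a b : ℤ) - 1)
      ≤ ∑ x ∈ IsEar.outer p L, weight (G.dist a b) (offset G a b x))
    (hXq : 4 * ((G.dist a b : ℤ) - 1)
      ≤ ∑ x ∈ IsEar.outer q M, weight (G.dist a b) (offset G a b x)) :
    15 ≤ energy G p L + energy G q M ∨
      4 ≤ energy G p L + energy G q M ∧ L = 2 ∧ M = 2 ∧ G.dist a b = 2 := by
  have hDL := hp.dist_ends_le hG
  have hp1 := hp.endGap_of_eq_dist hG
  have hq1 := hq.endGap_of_eq_dist hG
  have hq2 := hq.endGap_of_eq_dist_add_one hG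
  have hq3 := hq.endGap_of_dist_add_two_le hG
  rw [hp0, hpL] at hDL hp1
  rw [hq0, hqM] at hq1 hq2 hq3
  have hEp : 0 ≤ energy G p L := energy_nonneg
  have hEq := sq_endGap_le (G := G) (p := q) hM
  have hEp' := sq_endGap_le (G := G) (p := p) (L := L)
  obtain h | h | h : G.dist a b + 2 ≤ M ∨ M = G.dist a b + 1 ∨ M = G.dist a b := by omega
  · have := hq3 h
    have : 6 ≤ endGap G q M := by omega
    left; nlinarith
  · have := hq2 h hab hXq
    have : 6 ≤ endGap G q M := by omega
    left; nlinarith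
  · have h2 := hq1 h hXq
    have hL : L = M := by omega
    have h1 := hp1 (by omega) hXp
    have hEp' := hEp' (by omega)
    rcases hM.eq_or_lt with h' | h'
    · right
      have : 2 ≤ endGap G q M := by omega
      have : 2 ≤ endGap G p L := by omega
      exact ⟨by nlinarith, by omega, by omega, by omega⟩
    · left
      have : 4 ≤ endGap G q M := by omega
      have : 4 ≤ endGap G p L := by omega
      nlinarith

end EarPair

section Theta

open SimpleGraph

variable {V : Type*} {G : SimpleGraph V}

namespace IntDisj

variable {a b a' b' : V} {P : G.Walk a b} {P' : G.Walk a' b'}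

lemma symm (h : IntDisj P P') : IntDisj P' P := fun v hv hv' => (h v hv' hv).symm

lemma reverse_left (h : IntDisj P P') : IntDisj P.reverse P' := fun v hv hv' => by
  rw [or_comm (a := v = b)]
  exact h v (by simpa using hv) hv'

lemma reverse_right (h : IntDisj P P') : IntDisj P P'.reverse := h.symm.reverse_left.symm

lemma reverse (h : IntDisj P P') : IntDisj P.reverse P'.reverse := h.reverse_left.reverse_right

lemma mem_outer [Fintype V] (h : IntDisj P P') (hP : P.IsPath) {v : V} (hv : v ∈ P'.support) :
    v ∈ IsEar.outer P.getVert P.length := by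
  rw [IsEar.mem_outer]
  rintro i h0 hL rfl
  rcases (h _ (P.getVert_mem_support i) hv).1 with h | h
  · rw [hP.getVert_eq_start_iff hL.le] at h; omega
  · rw [hP.getVert_eq_end_iff hL.le] at h; omega

lemma eq_of_mem_edges (h : IntDisj P P') {e : Sym2 V} (he : e ∈ P.edges) (he' : e ∈ P'.edges) :
    e = s(a, b) ∧ e = s(a', b') := by
  induction e with | _ u v =>
  have hne : u ≠ v := (P.adj_of_mem_edges he).ne
  have hu := h u (P.fst_mem_support_of_mem_edges he) (P'.fst_mem_support_of_mem_edges he')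
  have hv := h v (P.snd_mem_support_of_mem_edges he) (P'.snd_mem_support_of_mem_edges he')
  simp only [Sym2.eq_iff]
  grind

lemma disjoint_edges (h : IntDisj P P') (hne : s(a, b) ≠ s(a', b')) :
    List.Disjoint P.edges P'.edges := fun _ he he' =>
  hne ((h.eq_of_mem_edges he he').1.symm.trans (h.eq_of_mem_edges he he').2)

lemma disjoint_edges' {P P' : G.Walk a b} (h : IntDisj P P') (hP : P.IsPath) (hP' : P'.IsPath)
    (hne : P ≠ P') : List.Disjoint P.edges P'.edges := fun e he he' => by
  obtain rfl := (h.eq_of_mem_edges he he').1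
  exact hne ((hP.eq_adj_toWalk_of_mem_edges he).trans (hP'.eq_adj_toWalk_of_mem_edges he').symm)

end IntDisj

lemma SimpleGraph.Walk.IsPath.isEar {a b : V} {P : G.Walk a b} (hP : P.IsPath) (hab : a ≠ b)
    (h : ∀ e ∈ G.edgeSet, e ∈ P.edges ∨ ∀ v ∈ e, v ∈ P.support → v = a ∨ v = b) :
    IsEar G P.getVert P.length where
  pos := by
    rcases Nat.eq_zero_or_pos P.length with h | h
    · exact absurd (Walk.eq_of_length_eq_zero h) hab
    · exact h
  adj i hi := P.adj_getVert_succ hi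
  inj := hP.getVert_injOn
  nbr i x h0 hi hx := by
    rcases h s(P.getVert i, x) hx with he | he
    · obtain ⟨j, hj, hj'⟩ := (Walk.mk_mem_edges_iff_exists _).mp he
      rw [Sym2.eq_iff] at hj'
      rcases hj' with ⟨h1, rfl⟩ | ⟨rfl, h2⟩
      · obtain rfl : j = i := hP.getVert_injOn hj.le hi.le h1
        exact .inr rfl
      · obtain rfl : j + 1 = i := hP.getVert_injOn (by exact hj) hi.le h2
        exact .inl rfl
    · rcases he _ (Sym2.mem_mk_left _ _) (P.getVert_mem_support i) with h | h
      · rw [hP.getVert_eq_start_iff hi.le] at h; omega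
      · rw [hP.getVert_eq_end_iff hi.le] at h; omega

lemma energy_getVert [Fintype V] {a b : V} (P : G.Walk a b) :
    energy G P.getVert P.length = (P.edges.map (transGap G)).sum := by
  induction P with
  | nil => simp [energy]
  | cons h P ih =>
    simp only [energy] at ih
    simp only [energy, Walk.length_cons, sum_range_succ', Walk.getVert_cons_succ,
      Walk.getVert_zero, ih, Walk.edges_cons, List.map_cons, List.sum_cons]
    exact add_comm _ _

namespace Theta3Cond

variable {w y x z : V} {Q₁ Q₂ : G.Walk w y} {R₁ R₂ : G.Walk x z} {S : G.Walk w x}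
  {T : G.Walk y z}

lemma swap (h : Theta3Cond G w y x z Q₁ Q₂ R₁ R₂ S T) :
    Theta3Cond G w y x z Q₂ Q₁ R₁ R₂ S T := by
  obtain ⟨d1, d2, d3, d4, d5, d6, p1, p2, p3, p4, p5, p6, n1, n2, i1, i2, i3, i4, i5, i6, i7, i8,
    i9, i10, i11, i12, i13, i14, i15, hV, hE⟩ := h
  refine ⟨d1, d2, d3, d4, d5, d6, p2, p1, p3, p4, p5, p6, n1.symm, n2, i1.symm, i6, i7, i8, i9,
    i2, i3, i4, i5, i10, i11, i12, i13, i14, i15, fun v => ?_, fun e he => ?_⟩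
  · have := hV v; tauto
  · have := hE e he; tauto

lemma exchange (h : Theta3Cond G w y x z Q₁ Q₂ R₁ R₂ S T) :
    Theta3Cond G x z w y R₁ R₂ Q₁ Q₂ S.reverse T.reverse := by
  obtain ⟨d1, d2, d3, d4, d5, d6, p1, p2, p3, p4, p5, p6, n1, n2, i1, i2, i3, i4, i5, i6, i7, i8,
    i9, i10, i11, i12, i13, i14, i15, hV, hE⟩ := h
  refine ⟨d6, d2.symm, d4.symm, d3.symm, d5.symm, d1, p3, p4, p1, p2, p5.reverse, p6.reverse, n2,
    n1, i10, i2.symm, i6.symm, i11.reverse_right, i12.reverse_right, i3.symm, i7.symm,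
    i14.reverse_right, i15.reverse_right, i1, i4.reverse_right, i5.reverse_right, i13.reverse,
    i8.reverse_right, i9.reverse_right, fun v => ?_, fun e he => ?_⟩
  · have := hV v; simp only [Walk.support_reverse, List.mem_reverse]; tauto
  · have := hE e he; simp only [Walk.edges_reverse, List.mem_reverse]; tauto

lemma reverse (h : Theta3Cond G w y x z Q₁ Q₂ R₁ R₂ S T) :
    Theta3Cond G y w z x Q₁.reverse Q₂.reverse R₁.reverse R₂.reverse T S := by
  obtain ⟨d1, d2, d3, d4, d5, d6, p1, p2, p3, p4, p5, p6, n1, n2, i1, i2, i3, i4, i5, i6, i7, i8,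
    i9, i10, i11, i12, i13, i14, i15, hV, hE⟩ := h
  have hinj {a b : V} {P P' : G.Walk a b} (hne : P ≠ P') : P.reverse ≠ P'.reverse := fun e =>
    hne (by rw [← P.reverse_reverse, e, P'.reverse_reverse])
  refine ⟨d1.symm, d5, d4, d3, d2, d6.symm, p1.reverse, p2.reverse, p3.reverse, p4.reverse, p6, p5,
    hinj n1, hinj n2, i1.reverse, i2.reverse, i3.reverse, i5.reverse_left, i4.reverse_left,
    i6.reverse, i7.reverse, i9.reverse_left, i8.reverse_left, i10.reverse, i12.reverse_left,
    i11.reverse_left, i13.symm, i15.reverse_left, i14.reverse_left, fun v => ?_, fun e he => ?_⟩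
  · have := hV v; simp only [Walk.support_reverse, List.mem_reverse]; tauto
  · have := hE e he; simp only [Walk.edges_reverse, List.mem_reverse]; tauto

lemma connected (h : Theta3Cond G w y x z Q₁ Q₂ R₁ R₂ S T) : G.Connected := by
  obtain ⟨-, -, -, -, -, -, -, -, -, -, -, -, -, -, -, -, -, -, -, -, -, -, -, -, -, -, -, -, -,
    hV, -⟩ := h
  refine connected_iff_exists_forall_reachable _ |>.mpr ⟨w, fun v => ?_⟩
  rcases hV v with h | h | h | h | h | h
  · exact (Q₁.takeUntil v h).reachable
  · exact (Q₂.takeUntil v h).reachable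
  · exact S.reachable.trans (R₁.takeUntil v h).reachable
  · exact S.reachable.trans (R₂.takeUntil v h).reachable
  · exact (S.takeUntil v h).reachable
  · exact Q₁.reachable.trans (T.takeUntil v h).reachable

lemma isEar_cycle (h : Theta3Cond G w y x z Q₁ Q₂ R₁ R₂ S T) :
    IsEar G Q₁.getVert Q₁.length := by
  obtain ⟨d1, d2, d3, d4, d5, d6, p1, p2, p3, p4, p5, p6, n1, n2, i1, i2, i3, i4, i5, i6, i7, i8,
    i9, i10, i11, i12, i13, i14, i15, hV, hE⟩ := h
  have key {a b : V} {P : G.Walk a b} (hi : IntDisj Q₁ P) {e : Sym2 V} (he : e ∈ P.edges) :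
      ∀ v ∈ e, v ∈ Q₁.support → v = w ∨ v = y := fun v hv hv' =>
    (hi v hv' (Walk.mem_support_of_mem_edges he hv)).1
  refine p1.isEar d1 fun e he => ?_
  rcases hE e he with h | h | h | h | h | h
  exacts [.inl h, .inr (key i1 h), .inr (key i2 h), .inr (key i3 h), .inr (key i4 h),
    .inr (key i5 h)]

lemma isEar_bridge (h : Theta3Cond G w y x z Q₁ Q₂ R₁ R₂ S T) :
    IsEar G S.getVert S.length := by
  obtain ⟨d1, d2, d3, d4, d5, d6, p1, p2, p3, p4, p5, p6, n1, n2, i1, i2, i3, i4, i5, i6, i7, i8,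
    i9, i10, i11, i12, i13, i14, i15, hV, hE⟩ := h
  have key {a b : V} {P : G.Walk a b} (hi : IntDisj S P) {e : Sym2 V} (he : e ∈ P.edges) :
      ∀ v ∈ e, v ∈ S.support → v = w ∨ v = x := fun v hv hv' =>
    (hi v hv' (Walk.mem_support_of_mem_edges he hv)).1
  refine p5.isEar d2 fun e he => ?_
  rcases hE e he with h | h | h | h | h | h
  exacts [.inr (key i4.symm h), .inr (key i8.symm h), .inr (key i11.symm h),
    .inr (key i14.symm h), .inl h, .inr (key i13 h)]

lemma sum_edgeFinset [Fintype V] (h : Theta3Cond G w y x z Q₁ Q₂ R₁ R₂ S T) (f : Sym2 V → ℤ) :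
    ∑ e ∈ G.edgeFinset, f e
      = (Q₁.edges.map f).sum + (Q₂.edges.map f).sum + (R₁.edges.map f).sum
        + (R₂.edges.map f).sum + (S.edges.map f).sum + (T.edges.map f).sum := by
  obtain ⟨d1, d2, d3, d4, d5, d6, p1, p2, p3, p4, p5, p6, n1, n2, i1, i2, i3, i4, i5, i6, i7, i8,
    i9, i10, i11, i12, i13, i14, i15, hV, hE⟩ := h
  let l := Q₁.edges ++ (Q₂.edges ++ (R₁.edges ++ (R₂.edges ++ (S.edges ++ T.edges))))
  have hl : l.Nodup := by
    simp only [l, List.nodup_append', List.disjoint_append_right]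
    have d1' := d1.symm
    have d2' := d2.symm
    have d3' := d3.symm
    have d4' := d4.symm
    have d5' := d5.symm
    have d6' := d6.symm
    refine ⟨p1.isTrail.edges_nodup, ⟨p2.isTrail.edges_nodup, ⟨p3.isTrail.edges_nodup,
      ⟨p4.isTrail.edges_nodup, ⟨p5.isTrail.edges_nodup, p6.isTrail.edges_nodup, ?_⟩, ?_, ?_⟩,
      ?_, ?_, ?_⟩, ?_, ?_, ?_, ?_⟩, ?_, ?_, ?_, ?_, ?_⟩
    · exact i13.disjoint_edges (by simp [*])
    · exact i14.disjoint_edges (by simp [*])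
    · exact i15.disjoint_edges (by simp [*])
    · exact i10.disjoint_edges' p3 p4 n2
    · exact i11.disjoint_edges (by simp [*])
    · exact i12.disjoint_edges (by simp [*])
    · exact i6.disjoint_edges (by simp [*])
    · exact i7.disjoint_edges (by simp [*])
    · exact i8.disjoint_edges (by simp [*])
    · exact i9.disjoint_edges (by simp [*])
    · exact i1.disjoint_edges' p1 p2 n1
    · exact i2.disjoint_edges (by simp [*])
    · exact i3.disjoint_edges (by simp [*])
    · exact i4.disjoint_edges (by simp [*])
    · exact i5.disjoint_edges (by simp [*])
  have hle : G.edgeFinset = l.toFinset := by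
    ext e
    simp only [mem_edgeFinset, List.mem_toFinset, l, List.mem_append]
    refine ⟨hE e, ?_⟩
    rintro (h | h | h | h | h | h) <;> exact Walk.edges_subset_edgeSet _ h
  rw [hle, List.sum_toFinset _ hl]
  simp only [l, List.map_append, List.sum_append]
  ring

lemma sum_transGap [Fintype V] (h : Theta3Cond G w y x z Q₁ Q₂ R₁ R₂ S T) :
    ∑ e ∈ G.edgeFinset, transGap G e
      = energy G Q₁.getVert Q₁.length + energy G Q₂.getVert Q₂.length
        + energy G R₁.getVert R₁.length + energy G R₂.getVert R₂.length
        + energy G S.getVert S.length + energy G T.getVert T.length := by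
  simp only [energy_getVert, h.sum_edgeFinset]

lemma card_edgeFinset [Fintype V] (h : Theta3Cond G w y x z Q₁ Q₂ R₁ R₂ S T) :
    (#G.edgeFinset : ℤ) = Q₁.length + Q₂.length + R₁.length + R₂.length + S.length
      + T.length := by
  have := h.sum_edgeFinset fun _ => 1
  simpa using this

lemma sum_univ [Fintype V] (h : Theta3Cond G w y x z Q₁ Q₂ R₁ R₂ S T) (f : V → ℤ) :
    ∑ v, f v = f w + f x + ∑ i ∈ Ioo 0 Q₁.length, f (Q₁.getVert i)
      + ∑ i ∈ Ioo 0 Q₂.length, f (Q₂.getVert i) + ∑ i ∈ Ioo 0 R₁.length, f (R₁.getVert i)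
      + ∑ i ∈ Ioo 0 R₂.length, f (R₂.getVert i) + ∑ i ∈ Ioo 0 S.length, f (S.getVert i)
      + ∑ i ∈ range (T.length + 1), f (T.getVert i) := by
  have hQ₁ := h.isEar_cycle
  have hQ₂ := h.swap.isEar_cycle
  have hR₁ := h.exchange.isEar_cycle
  have hR₂ := h.exchange.swap.isEar_cycle
  have hS := h.isEar_bridge
  have hT := h.reverse.isEar_bridge
  obtain ⟨d1, d2, d3, d4, d5, d6, p1, p2, p3, p4, p5, p6, n1, n2, i1, i2, i3, i4, i5, i6, i7, i8,
    i9, i10, i11, i12, i13, i14, i15, hV, hE⟩ := h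
  have inner {a b : V} {P : G.Walk a b} (hP : P.IsPath) {v : V} :
      v ∈ (Ioo 0 P.length).image P.getVert ↔ v ∈ P.support ∧ v ≠ a ∧ v ≠ b := by
    simp only [mem_image, mem_Ioo, Walk.mem_support_iff_exists_getVert]
    constructor
    · rintro ⟨i, ⟨h0, hi⟩, rfl⟩
      rw [ne_eq, ne_eq, hP.getVert_eq_start_iff hi.le, hP.getVert_eq_end_iff hi.le]
      exact ⟨⟨i, rfl, hi.le⟩, by omega, by omega⟩
    · rintro ⟨⟨i, rfl, hi⟩, ha, hb⟩
      rw [ne_eq, hP.getVert_eq_start_iff hi] at ha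
      rw [ne_eq, hP.getVert_eq_end_iff hi] at hb
      exact ⟨i, by omega, rfl⟩
  have hTs : ∀ v, v ∈ (range (T.length + 1)).image T.getVert ↔ v ∈ T.support := fun v => by
    simp only [mem_image, mem_range, Walk.mem_support_iff_exists_getVert, Nat.lt_succ_iff]
    exact ⟨fun ⟨i, hi, e⟩ => ⟨i, e, hi⟩, fun ⟨i, e, hi⟩ => ⟨i, hi, e⟩⟩
  rw [← sum_image (f := f) hQ₁.injOn_Ioo, ← sum_image (f := f) hQ₂.injOn_Ioo,
    ← sum_image (f := f) hR₁.injOn_Ioo, ← sum_image (f := f) hR₂.injOn_Ioo,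
    ← sum_image (f := f) hS.injOn_Ioo, ← sum_image (f := f) (s := range (T.length + 1))
      (hT.inj.mono fun i hi => Nat.lt_succ_iff.mp (by simpa using hi)),
    ← sum_pair d2, ← sum_union, ← sum_union, ← sum_union, ← sum_union, ← sum_union, ← sum_union]
  · refine sum_congr (Eq.symm ?_) fun _ _ => rfl
    ext v
    simp only [mem_union, inner p1, inner p2, inner p3, inner p4, inner p5, hTs, mem_insert,
      mem_singleton, mem_univ, iff_true]
    have := hV v
    have hy : y ∈ T.support := T.start_mem_support
    have hz : z ∈ T.support := T.end_mem_support
    grind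
  all_goals
    rw [Finset.disjoint_left]
    intro v hv
    simp only [mem_union, inner p1, inner p2, inner p3, inner p4, inner p5, hTs, mem_insert,
      mem_singleton] at hv ⊢
    have hw : v = w → v ∈ Q₁.support := fun e => e ▸ Q₁.start_mem_support
    have hx : v = x → v ∈ R₁.support := fun e => e ▸ R₁.start_mem_support
    clear hV hE
    grind [IntDisj]


lemma card_univ [Fintype V] (h : Theta3Cond G w y x z Q₁ Q₂ R₁ R₂ S T) :
    Fintype.card V + 2 = Q₁.length + Q₂.length + R₁.length + R₂.length + S.length + T.length := by
  have hQ₁ := h.isEar_cycle.pos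
  have hQ₂ := h.swap.isEar_cycle.pos
  have hR₁ := h.exchange.isEar_cycle.pos
  have hR₂ := h.exchange.swap.isEar_cycle.pos
  have hS := h.isEar_bridge.pos
  have := h.sum_univ fun _ => 1
  simp only [sum_const, Nat.card_Ioo, Finset.card_univ, card_range, nsmul_eq_mul] at this
  omega

lemma three_le_length_add (h : Theta3Cond G w y x z Q₁ Q₂ R₁ R₂ S T) :
    3 ≤ Q₁.length + Q₂.length := by
  have hQ₁ := h.isEar_cycle.pos
  have hQ₂ := h.swap.isEar_cycle.pos
  obtain ⟨-, -, -, -, -, -, p1, p2, -, -, -, -, n1, -, i1, -⟩ := h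
  have mem {P : G.Walk w y} (hP : P.length = 1) : s(w, y) ∈ P.edges := by
    refine (Walk.mk_mem_edges_iff_exists P).mpr ⟨0, by omega, ?_⟩
    rw [Walk.getVert_zero, zero_add, ← hP, Walk.getVert_length]
  by_contra hlt
  exact i1.disjoint_edges' p1 p2 n1 (mem (by omega)) (mem (by omega))

/-- The first edge of a shortest path from a branch vertex determines a whole ear. -/
lemma dist_branch [Fintype V] (h : Theta3Cond G w y x z Q₁ Q₂ R₁ R₂ S T) {u : V} (hu : w ≠ u)
    (h₁ : u ∈ IsEar.outer Q₁.getVert Q₁.length) (h₂ : u ∈ IsEar.outer Q₂.getVert Q₂.length)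
    (hS : u ∈ IsEar.outer S.getVert S.length) :
    G.dist w u = Q₁.length + G.dist y u ∨ G.dist w u = Q₂.length + G.dist y u ∨
      G.dist w u = S.length + G.dist x u := by
  have hG := h.connected
  have e₁ := h.isEar_cycle.dist_zero_eq_of_dist_one hG (IsEar.mem_outer.mp h₁)
  have e₂ := h.swap.isEar_cycle.dist_zero_eq_of_dist_one hG (IsEar.mem_outer.mp h₂)
  have e₃ := h.isEar_bridge.dist_zero_eq_of_dist_one hG (IsEar.mem_outer.mp hS)
  simp only [Walk.getVert_zero, Walk.getVert_length] at e₁ e₂ e₃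
  obtain ⟨d1, d2, d3, d4, d5, d6, p1, p2, p3, p4, p5, p6, n1, n2, i1, i2, i3, i4, i5, i6, i7, i8,
    i9, i10, i11, i12, i13, i14, i15, hV, hE⟩ := h
  obtain ⟨v, hv, hd⟩ := exists_adj_dist_add_one_eq hG hu
  have absurd' {a b : V} {P : G.Walk a b} (hi : IntDisj Q₁ P) (ha : w ≠ a) (hb : w ≠ b) :
      s(w, v) ∉ P.edges := fun he => by
    have := (hi w Q₁.start_mem_support (Walk.fst_mem_support_of_mem_edges _ he)).2
    tauto
  rcases hE s(w, v) hv with h | h | h | h | h | h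
  · exact .inl (e₁ (by rw [p1.eq_snd_of_mem_edges h] at hd; exact hd))
  · exact .inr (.inl (e₂ (by rw [p2.eq_snd_of_mem_edges h] at hd; exact hd)))
  · exact absurd h (absurd' i2 d2 d3)
  · exact absurd h (absurd' i3 d2 d3)
  · exact .inr (.inr (e₃ (by rw [p5.eq_snd_of_mem_edges h] at hd; exact hd)))
  · exact absurd h (absurd' i5 d1 d3)

lemma four_mul_le_sum_weight [Fintype V] (h : Theta3Cond G w y x z Q₁ Q₂ R₁ R₂ S T) :
    4 * ((G.dist w y : ℤ) - 1)
      ≤ ∑ v ∈ IsEar.outer Q₁.getVert Q₁.length, weight (G.dist w y) (offset G w y v) := by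
  have hG := h.connected
  obtain ⟨d1, d2, d3, d4, d5, d6, p1, p2, p3, p4, p5, p6, n1, n2, i1, i2, i3, i4, i5, i6, i7, i8,
    i9, i10, i11, i12, i13, i14, i15, hV, hE⟩ := h
  have hW : ∀ v ∈ (S.append (R₁.append T.reverse)).bypass.support,
      v ∈ S.support ∨ v ∈ R₁.support ∨ v ∈ T.support := fun v hv => by
    simpa using Walk.support_bypass_subset_support _ hv
  refine crossing_two hG d1 p2 (Walk.bypass_isPath (S.append (R₁.append T.reverse)))
    (fun v hv hv' => ?_) (fun v hv => i1.mem_outer p1 hv) (fun v hv => ?_)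
  · rcases hW v hv' with h | h | h
    exacts [(i8 v hv h).1, (i6 v hv h).1, (i9 v hv h).1]
  · rcases hW v hv with h | h | h
    exacts [i4.mem_outer p1 h, i2.mem_outer p1 h, i5.mem_outer p1 h]

lemma energy_add_energy [Fintype V] (h : Theta3Cond G w y x z Q₁ Q₂ R₁ R₂ S T)
    (hn : 12 ≤ Fintype.card V) :
    15 ≤ energy G Q₁.getVert Q₁.length + energy G Q₂.getVert Q₂.length ∨
      4 ≤ energy G Q₁.getVert Q₁.length + energy G Q₂.getVert Q₂.length ∧
        Q₁.length = 2 ∧ Q₂.length = 2 ∧ G.dist w y = 2 := by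
  have hG := h.connected
  have hcard := h.card_univ
  have hQ := h.three_le_length_add
  have hR := h.exchange.three_le_length_add
  have hS := h.isEar_bridge.pos
  have hT := h.reverse.isEar_bridge.pos
  rcases Nat.le_total Q₁.length Q₂.length with hle | hle
  · exact energy_add_energy_aux hG h.1 h.isEar_cycle h.swap.isEar_cycle Q₁.getVert_zero
      Q₁.getVert_length Q₂.getVert_zero Q₂.getVert_length hle (by omega) (by omega) hn
      h.four_mul_le_sum_weight h.swap.four_mul_le_sum_weight
  · have := energy_add_energy_aux hG h.1 h.swap.isEar_cycle h.isEar_cycle Q₂.getVert_zero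
      Q₂.getVert_length Q₁.getVert_zero Q₁.getVert_length hle (by omega) (by omega) hn
      h.swap.four_mul_le_sum_weight h.four_mul_le_sum_weight
    omega

lemma dist_branch_near [Fintype V] (h : Theta3Cond G w y x z Q₁ Q₂ R₁ R₂ S T) :
    G.dist w x = Q₁.length + G.dist y x ∨ G.dist w x = Q₂.length + G.dist y x ∨
      G.dist w x = S.length := by
  have hb := h.dist_branch (u := x) h.2.1
  have hx := h.isEar_bridge.end_mem_outer
  rw [Walk.getVert_length] at hx
  obtain ⟨-, -, -, -, -, -, p1, p2, -, -, -, -, -, -, -, i2, -, -, -, i6, -⟩ := h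
  simpa using hb (i2.mem_outer p1 R₁.start_mem_support) (i6.mem_outer p2 R₁.start_mem_support) hx

lemma dist_branch_far [Fintype V] (h : Theta3Cond G w y x z Q₁ Q₂ R₁ R₂ S T) :
    G.dist w z = Q₁.length + G.dist y z ∨ G.dist w z = Q₂.length + G.dist y z ∨
      G.dist w z = S.length + G.dist x z := by
  have hb := h.dist_branch (u := z) h.2.2.1
  obtain ⟨-, -, -, -, -, -, p1, p2, -, -, p5, -, -, -, -, i2, -, -, -, i6, -, -, -, -, -, -, i13,
    -⟩ := h
  exact hb (i2.mem_outer p1 R₁.end_mem_support) (i6.mem_outer p2 R₁.end_mem_support)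
    (i13.mem_outer p5 T.end_mem_support)

/-- The cycles of the Θ₃-graph are two isometric 4-cycles, and `S` is not longer than `T`. -/
structure IsSquare (G : SimpleGraph V) (Q₁ Q₂ : G.Walk w y) (R₁ R₂ : G.Walk x z) (S : G.Walk w x)
    (T : G.Walk y z) : Prop where
  theta : Theta3Cond G w y x z Q₁ Q₂ R₁ R₂ S T
  length_Q₁ : Q₁.length = 2
  length_Q₂ : Q₂.length = 2
  length_R₁ : R₁.length = 2
  length_R₂ : R₂.length = 2
  dist_wy : G.dist w y = 2
  dist_xz : G.dist x z = 2
  le : S.length ≤ T.length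

namespace IsSquare

lemma swap (h : IsSquare G Q₁ Q₂ R₁ R₂ S T) : IsSquare G Q₂ Q₁ R₁ R₂ S T :=
  ⟨h.theta.swap, h.3, h.2, h.4, h.5, h.6, h.7, h.8⟩

lemma exchange (h : IsSquare G Q₁ Q₂ R₁ R₂ S T) :
    IsSquare G R₁ R₂ Q₁ Q₂ S.reverse T.reverse :=
  ⟨h.theta.exchange, h.4, h.5, h.2, h.3, h.7, h.6, by simpa using h.8⟩

/-- The middle vertex of one path of a 4-cycle is adjacent to both ends of the other. -/
lemma dist_mid_self (h : IsSquare G Q₁ Q₂ R₁ R₂ S T) :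
    G.dist w (Q₁.getVert 1) = 1 ∧ G.dist y (Q₁.getVert 1) = 1 := by
  have h0 := Q₁.adj_getVert_succ (i := 0) (by rw [h.length_Q₁]; omega)
  have h1 := Q₁.adj_getVert_succ (i := 1) (by rw [h.length_Q₁]; omega)
  have h2 := Q₁.getVert_length
  rw [h.length_Q₁] at h2
  rw [Walk.getVert_zero] at h0
  rw [h2] at h1
  exact ⟨dist_eq_one_iff_adj.mpr h0, dist_eq_one_iff_adj.mpr h1.symm⟩

variable [Fintype V]

lemma dist_eq (h : IsSquare G Q₁ Q₂ R₁ R₂ S T) :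
    G.dist w x = S.length ∧ G.dist y x = S.length + 2 ∧ G.dist w z = S.length + 2 ∧
      G.dist y z = min T.length (S.length + 4) := by
  have h1 := h.theta.dist_branch_near
  have h2 := h.theta.dist_branch_far
  have h3 := h.theta.reverse.dist_branch_near
  have h4 := h.theta.reverse.dist_branch_far
  have hS := h.theta.isEar_bridge.dist_ends_le h.theta.connected
  have hT := h.theta.reverse.isEar_bridge.dist_ends_le h.theta.connected
  simp only [Walk.getVert_zero, Walk.getVert_length] at hS hT
  simp only [Walk.length_reverse, h.length_Q₁, h.length_Q₂, h.dist_xz, dist_comm (u := z),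
    or_self_left] at h1 h2 h3 h4
  have h5 := h.theta.connected.dist_triangle (u := y) (v := w) (w := x)
  have h6 := h.theta.connected.dist_triangle (u := w) (v := x) (w := z)
  have h7 := h.theta.connected.dist_triangle (u := y) (v := w) (w := z)
  rw [dist_comm (u := y) (v := w), h.dist_wy] at h5 h7
  rw [h.dist_xz] at h6
  have := h.le
  omega

lemma dist_mid (h : IsSquare G Q₁ Q₂ R₁ R₂ S T) {u : V}
    (hu : u ∈ IsEar.outer Q₁.getVert Q₁.length) :
    G.dist (Q₁.getVert 1) u = min (1 + G.dist w u) (1 + G.dist y u) := by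
  have := h.theta.isEar_cycle.dist_eq h.theta.connected (IsEar.mem_outer.mp hu) (i := 1)
    (by rw [h.length_Q₁]; omega)
  rw [Walk.getVert_zero, Walk.getVert_length, h.length_Q₁] at this
  exact this

lemma dist_mid_opposite (h : IsSquare G Q₁ Q₂ R₁ R₂ S T) :
    G.dist w (R₁.getVert 1) = S.length + 1 ∧
      G.dist y (R₁.getVert 1) = min (S.length + 3) (T.length + 1) := by
  have ⟨h1, h2, h3, h4⟩ := h.dist_eq
  have hw := h.exchange.dist_mid (u := w)
  have hy := h.exchange.dist_mid (u := y)
  obtain ⟨-, -, -, -, -, -, -, -, p3, -, -, -, -, -, -, i2, -⟩ := h.theta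
  have hw := hw (i2.symm.mem_outer p3 Q₁.start_mem_support)
  have hy := hy (i2.symm.mem_outer p3 Q₁.end_mem_support)
  rw [dist_comm, dist_comm (u := x), dist_comm (u := z)] at hw hy
  have := h.le
  omega

lemma sum_outer (h : IsSquare G Q₁ Q₂ R₁ R₂ S T) (f : V → ℤ) :
    ∑ v ∈ IsEar.outer Q₁.getVert Q₁.length, f v
      = f w + f x + f (Q₂.getVert 1) + f (R₁.getVert 1) + f (R₂.getVert 1)
        + ∑ i ∈ Ioo 0 S.length, f (S.getVert i)
        + ∑ i ∈ range (T.length + 1), f (T.getVert i) := by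
  have h1 := h.theta.isEar_cycle.sum_eq f
  have h2 : Ioo 0 2 = {1} := rfl
  rw [h.theta.sum_univ, h.length_Q₁, h.length_Q₂, h.length_R₁, h.length_R₂, h2] at h1
  simp only [sum_singleton] at h1
  rw [h.length_Q₁]
  linarith

lemma endGap_ge (h : IsSquare G Q₁ Q₂ R₁ R₂ S T) (hT : T.length ≤ S.length + 1) :
    3 ≤ endGap G Q₁.getVert Q₁.length := by
  have hG := h.theta.connected
  have h0 := h.theta.isEar_cycle.endGap_eq hG
  rw [h.sum_outer] at h0
  simp only [Walk.getVert_zero, Walk.getVert_length] at h0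
  rw [h.length_Q₁, h.dist_wy] at h0
  have hnn (v : V) : 0 ≤ weight ((2 : ℕ) : ℤ) (offset G w y v) :=
    weight_nonneg (by norm_num) (h.dist_wy ▸ abs_offset_le hG w y v)
  have hS := sum_nonneg fun i (_ : i ∈ Ioo 0 S.length) => hnn (S.getVert i)
  have hT' := single_le_sum (fun i _ => hnn (T.getVert i)) (self_mem_range_succ T.length)
  have hw := hnn w
  have hx := hnn x
  obtain ⟨-, -, h3, h4⟩ := h.dist_eq
  have ⟨h5, h6⟩ := h.swap.dist_mid_self
  have ⟨h7, h8⟩ := h.dist_mid_opposite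
  have ⟨h9, h10⟩ := h.exchange.swap.exchange.dist_mid_opposite
  simp only [Walk.length_reverse] at h9 h10
  rw [h.length_Q₁, h0]
  have := h.le
  rw [Walk.getVert_length] at hT'
  have e1 : 2 ≤ weight ((2 : ℕ) : ℤ) (offset G w y (Q₂.getVert 1)) := by
    simp only [weight, offset, h5, h6]; omega
  have e2 : (1 : ℤ) + (S.length + 1 - T.length)
      ≤ weight ((2 : ℕ) : ℤ) (offset G w y (R₁.getVert 1)) := by
    simp only [weight, offset, h7, h8]; omega
  have e3 : (1 : ℤ) + (S.length + 1 - T.length)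
      ≤ weight ((2 : ℕ) : ℤ) (offset G w y (R₂.getVert 1)) := by
    simp only [weight, offset, h9, h10]; omega
  have e4 : (T.length : ℤ) - S.length ≤ weight ((2 : ℕ) : ℤ) (offset G w y z) := by
    simp only [weight, offset, h3, h4]; omega
  omega

lemma transmission_sub_ge (h : IsSquare G Q₁ Q₂ R₁ R₂ S T) (hT : S.length + 4 ≤ T.length) :
    2 ≤ transmission G (Q₁.getVert 1) - transmission G w := by
  have hG := h.theta.connected
  have h0 := h.theta.isEar_cycle.transmission_sub hG
  rw [h.sum_outer] at h0
  simp only [Walk.getVert_zero, Walk.getVert_length] at h0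
  rw [h.length_Q₁, h.dist_wy] at h0
  obtain ⟨h1, h2, h3, h4⟩ := h.dist_eq
  obtain ⟨h5, h6⟩ := h.swap.dist_mid_self
  obtain ⟨h7, h8⟩ := h.dist_mid_opposite
  obtain ⟨h9, h10⟩ := h.exchange.swap.exchange.dist_mid_opposite
  simp only [Walk.length_reverse] at h9 h10
  have hwy := h.dist_wy
  have hyw := h.dist_wy
  rw [dist_comm] at hyw
  have hSe := h.theta.isEar_bridge
  have hTe := h.theta.reverse.isEar_bridge
  have eS : ∑ i ∈ Ioo 0 S.length, min (1 : ℤ)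
      ((G.dist y (S.getVert i) : ℤ) - G.dist w (S.getVert i) + (2 : ℕ) - 1)
        = ∑ i ∈ Ioo 0 S.length, 1 := by
    refine sum_congr rfl fun i hi => ?_
    rw [mem_Ioo] at hi
    have hyo : y ∈ IsEar.outer S.getVert S.length := by
      obtain ⟨-, -, -, -, -, -, -, -, -, -, p5, -, -, -, -, -, -, -, -, -, -, -, -, -, -, -, i13,
        -⟩ := h.theta
      exact i13.mem_outer p5 T.start_mem_support
    have ey := hSe.dist_eq hG (IsEar.mem_outer.mp hyo) hi.2.le
    have ew := hSe.dist_le_add hG w hi.2.le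
    rw [Walk.getVert_zero, Walk.getVert_length, dist_comm, hwy, dist_comm (u := x), h2] at ey
    rw [Walk.getVert_zero, dist_comm, dist_self] at ew
    omega
  have hyT (i : ℕ) (hi : i ≤ T.length) :
      G.dist y (T.getVert i) = min i (T.length - i + (S.length + 4)) := by
    have := hTe.dist_eq hG (IsEar.mem_outer.mp hTe.start_mem_outer) hi
    rw [Walk.getVert_zero, Walk.getVert_length, dist_comm, dist_self, dist_comm (u := z), h4]
      at this
    omega
  have hwT (i : ℕ) (hi : i ≤ T.length) :
      G.dist w (T.getVert i) = min (i + 2) (T.length - i + (S.length + 2)) := by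
    have hwo : w ∈ IsEar.outer T.getVert T.length := by
      obtain ⟨-, -, -, -, -, -, -, -, -, -, -, p6, -, -, -, -, -, -, -, -, -, -, -, -, -, -, i13,
        -⟩ := h.theta
      exact i13.symm.mem_outer p6 S.start_mem_support
    have := hTe.dist_eq hG (IsEar.mem_outer.mp hwo) hi
    rw [Walk.getVert_zero, Walk.getVert_length, dist_comm, hyw, dist_comm (u := z), h3]
      at this
    omega
  have eT : ∑ i ∈ range (T.length + 1), min (1 : ℤ)
      ((G.dist y (T.getVert i) : ℤ) - G.dist w (T.getVert i) + (2 : ℕ) - 1)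
        = max (-((T.length : ℤ) + 1)) (T.length - (S.length + T.length : ℕ) - 1) := by
    apply sum_range_sign <;> intro i hi _ <;> rw [hyT i hi, hwT i hi] <;> omega
  rw [eS, eT, sum_const, Nat.card_Ioo, hyw, h1, h2, h5, h6, h7, h8, h9, h10, dist_self]
    at h0
  have := hSe.pos
  simp only [nsmul_eq_mul] at h0
  omega

lemma transmission_sub_ge_of_long (h : IsSquare G Q₁ Q₂ R₁ R₂ S T)
    (hT : S.length + 4 ≤ T.length) :
    2 ≤ transmission G (T.getVert 1) - transmission G y := by
  have hG := h.theta.connected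
  have hSe := h.theta.isEar_bridge
  have hTe := h.theta.reverse.isEar_bridge
  have h0 := hTe.transmission_sub hG
  have hz := hTe.end_mem_outer
  have hcard := hTe.card_outer
  have hcard' := h.theta.card_univ
  rw [h.length_Q₁, h.length_Q₂, h.length_R₁, h.length_R₂] at hcard'
  obtain ⟨h1, h2, h3, h4⟩ := h.dist_eq
  simp only [Walk.getVert_zero, Walk.getVert_length] at h0 hz
  have near : ∀ v ∈ IsEar.outer T.getVert T.length, v ≠ z → G.dist y v ≤ S.length + 3 := by
    have hS := hSe.pos
    have hQ₁ := h.theta.isEar_cycle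
    have hQ₂ := h.theta.swap.isEar_cycle
    have hR₁ := h.theta.exchange.isEar_cycle
    have hR₂ := h.theta.exchange.swap.isEar_cycle
    have bound {a b : V} {P : G.Walk a b} (hP : IsEar G P.getVert P.length) {i : ℕ}
        (hi : i ≤ P.length) : G.dist y (P.getVert i) ≤ i + G.dist y a := by
      have := hP.dist_le_add hG y hi
      rwa [Walk.getVert_zero, dist_comm, dist_comm (u := a)] at this
    have hyw := h.dist_wy
    rw [dist_comm] at hyw
    have hV := h.theta.2.2.2.2.2.2.2.2.2.2.2.2.2.2.2.2.2.2.2.2.2.2.2.2.2.2.2.2.2.1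
    intro v hv hvz
    rcases hV v with hv' | hv' | hv' | hv' | hv' | hv' <;>
      obtain ⟨i, rfl, hi⟩ := Walk.mem_support_iff_exists_getVert.mp hv'
    · have := bound hQ₁ hi
      have := h.length_Q₁
      omega
    · have := bound hQ₂ hi
      have := h.length_Q₂
      omega
    · have := bound hR₁ hi
      have := h.length_R₁
      have : i ≠ R₁.length := fun e => hvz (by rw [e, Walk.getVert_length])
      omega
    · have := bound hR₂ hi
      have := h.length_R₂
      have : i ≠ R₂.length := fun e => hvz (by rw [e, Walk.getVert_length])
      omega
    · have := bound hSe hi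
      omega
    · rcases Nat.eq_zero_or_pos i with rfl | h0
      · simp
      · rcases hi.eq_or_lt with rfl | hi
        · exact absurd T.getVert_length hvz
        · exact absurd rfl (IsEar.mem_outer.mp hv i h0 hi)
  have e1 : ∑ v ∈ (IsEar.outer T.getVert T.length).erase z,
      min (1 : ℤ) ((G.dist z v : ℤ) - G.dist y v + T.length - 1)
        = ∑ v ∈ (IsEar.outer T.getVert T.length).erase z, 1 := by
    refine sum_congr rfl fun v hv => ?_
    rw [mem_erase] at hv
    have := near v hv.2 hv.1
    have := hG.pos_dist_of_ne hv.1
    rw [dist_comm] at this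
    omega
  rw [← add_sum_erase _ _ hz, e1, sum_const, card_erase_of_mem hz, dist_self, h4] at h0
  have := card_pos.mpr ⟨z, hz⟩
  simp only [nsmul_eq_mul] at h0
  omega

lemma energy_ge (h : IsSquare G Q₁ Q₂ R₁ R₂ S T) (hT : T.length ≤ S.length + 1) :
    5 ≤ energy G Q₁.getVert Q₁.length := by
  have h1 := h.endGap_ge hT
  have h2 := sq_endGap_le (G := G) (p := Q₁.getVert) h.length_Q₁.ge
  nlinarith

lemma energy_ge_of_long (h : IsSquare G Q₁ Q₂ R₁ R₂ S T) (hT : S.length + 4 ≤ T.length) :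
    4 ≤ energy G Q₁.getVert Q₁.length := by
  have h1 := h.transmission_sub_ge hT
  have h2 := sq_add_sq_le_energy (G := G) (p := Q₁.getVert) h.length_Q₁.ge
  rw [Walk.getVert_zero] at h2
  nlinarith [sq_nonneg (transmission G (Q₁.getVert (Q₁.length - 1))
    - transmission G (Q₁.getVert Q₁.length))]

lemma sum_transGap_ge (h : IsSquare G Q₁ Q₂ R₁ R₂ S T) (hF : ¬ IsFGraph (Fintype.card V) G) :
    19 ≤ ∑ e ∈ G.edgeFinset, transGap G e := by
  rw [h.theta.sum_transGap]
  have hS : 0 ≤ energy G S.getVert S.length := energy_nonneg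
  have hT : 0 ≤ energy G T.getVert T.length := energy_nonneg
  rcases Nat.lt_or_ge (S.length + 1) T.length with hlt | hle
  · rcases Nat.lt_or_ge T.length (S.length + 4) with hlt' | hle
    · have hcard := h.theta.card_univ
      rw [h.length_Q₁, h.length_Q₂, h.length_R₁, h.length_R₂] at hcard
      refine absurd ⟨S.length, T.length, h.theta.isEar_bridge.pos,
        h.theta.reverse.isEar_bridge.pos, by omega, ?_, w, y, x, z, Q₁, Q₂, R₁, R₂, S, T, h.theta,
        h.length_Q₁, h.length_Q₂, h.length_R₁, h.length_R₂, rfl, rfl⟩ hF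
      split_ifs with he
      · rw [Nat.even_iff] at he
        omega
      · rw [Nat.even_iff] at he
        omega
    · have hQ₁ := h.energy_ge_of_long hle
      have hQ₂ := h.swap.energy_ge_of_long hle
      have hR₁ := h.exchange.energy_ge_of_long (by simpa using hle)
      have hR₂ := h.exchange.swap.energy_ge_of_long (by simpa using hle)
      have hT₁ := h.transmission_sub_ge_of_long hle
      have hT₂ := sq_add_sq_le_energy (G := G) (p := T.getVert) (L := T.length) (by omega)
      rw [Walk.getVert_zero] at hT₂
      have : 4 ≤ energy G T.getVert T.length := by
        nlinarith [sq_nonneg (transmission G (T.getVert (T.length - 1))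
          - transmission G (T.getVert T.length))]
      omega
  · have hQ₁ := h.energy_ge hle
    have hQ₂ := h.swap.energy_ge hle
    have hR₁ := h.exchange.energy_ge (by simpa using hle)
    have hR₂ := h.exchange.swap.energy_ge (by simpa using hle)
    omega

end IsSquare

theorem sum_transGap_ge [Fintype V] (h : Theta3Cond G w y x z Q₁ Q₂ R₁ R₂ S T)
    (hn : 12 ≤ Fintype.card V) (hF : ¬ IsFGraph (Fintype.card V) G) :
    19 ≤ ∑ e ∈ G.edgeFinset, transGap G e := by
  have hS : 0 ≤ energy G S.getVert S.length := energy_nonneg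
  have hT : 0 ≤ energy G T.getVert T.length := energy_nonneg
  have hsum := h.sum_transGap
  rcases h.energy_add_energy hn with hQ | ⟨hQ, hQ₁, hQ₂, hwy⟩ <;>
    rcases h.exchange.energy_add_energy hn with hR | ⟨hR, hR₁, hR₂, hxz⟩
  · omega
  · omega
  · omega
  · rcases Nat.le_total S.length T.length with hle | hle
    · exact IsSquare.sum_transGap_ge ⟨h, hQ₁, hQ₂, hR₁, hR₂, hwy, hxz, hle⟩ hF
    · exact IsSquare.sum_transGap_ge ⟨h.reverse, by simpa using hQ₁, by simpa using hQ₂,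
        by simpa using hR₁, by simpa using hR₂, by rwa [dist_comm], by rwa [dist_comm], hle⟩ hF

end Theta3Cond
end Theta

/-- A Θ₃-graph of order `n ≥ 12` not isomorphic to `Fₙ` has revised Szeged index
less than `B(n)`, where `B(n) = (n³+2n²−16)/4` for even `n` and `(n³+2n²−18)/4`
for odd `n`. -/
theorem revSz_lt_of_isTheta3 {V : Type*} [Fintype V] (G : SimpleGraph V)
    (hΘ : IsTheta3 G) (hn : 12 ≤ Fintype.card V)
    (hF : ¬ IsFGraph (Fintype.card V) G) :
    revSz G < if Even (Fintype.card V) then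
        ((Fintype.card V : ℚ) ^ 3 + 2 * (Fintype.card V : ℚ) ^ 2 - 16) / 4
      else
        ((Fintype.card V : ℚ) ^ 3 + 2 * (Fintype.card V : ℚ) ^ 2 - 18) / 4 := by
  obtain ⟨w, y, x, z, Q₁, Q₂, R₁, R₂, S, T, h⟩ := hΘ
  have hE := h.card_edgeFinset
  have hV := h.card_univ
  have hE' : (#G.edgeFinset : ℚ) = Fintype.card V + 2 := by
    have : #G.edgeFinset = Fintype.card V + 2 := by omega
    exact_mod_cast this
  have hgap : (19 : ℚ) ≤ (∑ e ∈ G.edgeFinset, transGap G e : ℤ) := by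
    exact_mod_cast h.sum_transGap_ge hn hF
  rw [revSz_eq h.connected, hE']
  split_ifs <;> linarith
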